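/- Let K be an (m+n)×(m+n) symmetric real matrix with generalized Cholesky factorization K = L·J_{m+n}·Lᵀ, where L is lower triangular with positive diagonal entries, and let ΔK be an (m+n)×(m+n) symmetric real matrix with ‖L⁻¹‖₂² · ‖ΔK‖_F < 1/2. If ΔL is a matrix such that L + ΔL is lower triangular with positive diagonal entries and K + ΔK = (L + ΔL)·J_{m+n}·(L + ΔL)ᵀ, then for every (m+n)×(m+n) diagonal matrix D with positive diagonal entries, ‖ΔL‖_F ≤ (2 + √2) · ‖L⁻¹‖₂ · κ₂(L·D⁻¹) · ‖ΔK‖_F. -/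

import Mathlib

open Matrix

noncomputable def frobNorm {k : ℕ} (A : Matrix (Fin k) (Fin k) ℝ) : ℝ :=
  Real.sqrt (∑ i, ∑ j, (A i j) ^ 2)

noncomputable def specNorm {k : ℕ} (A : Matrix (Fin k) (Fin k) ℝ) : ℝ :=
  ‖Matrix.toEuclideanCLM (𝕜 := ℝ) A‖

noncomputable def kappa2 {k : ℕ} (A : Matrix (Fin k) (Fin k) ℝ) : ℝ :=
  specNorm A⁻¹ * specNorm A

noncomputable def upTri {k : ℕ} (A : Matrix (Fin k) (Fin k) ℝ) : Matrix (Fin k) (Fin k) ℝ :=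
  Matrix.of fun i j => if i < j then A i j else if i = j then A i i / 2 else 0

noncomputable def Jmat (m n : ℕ) : Matrix (Fin (m + n)) (Fin (m + n)) ℝ :=
  Matrix.diagonal fun i => if (i : ℕ) < m then 1 else -1

def IsLowerTri {k : ℕ} (A : Matrix (Fin k) (Fin k) ℝ) : Prop :=
  ∀ i j, i < j → A i j = 0

def IsUpperTri {k : ℕ} (A : Matrix (Fin k) (Fin k) ℝ) : Prop :=
  ∀ i j, j < i → A i j = 0

def PosDiag {k : ℕ} (A : Matrix (Fin k) (Fin k) ℝ) : Prop :=
  ∀ i, 0 < A i i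

noncomputable def entAbs {k : ℕ} (A : Matrix (Fin k) (Fin k) ℝ) : Matrix (Fin k) (Fin k) ℝ :=
  Matrix.of fun i j => |A i j|

noncomputable def condF {k : ℕ} (A : Matrix (Fin k) (Fin k) ℝ) : ℝ :=
  frobNorm (entAbs A⁻¹ * entAbs A)

section FrobNorm

variable {k : ℕ}

theorem frobNorm_nonneg (A : Matrix (Fin k) (Fin k) ℝ) : 0 ≤ frobNorm A :=
  Real.sqrt_nonneg _

theorem frobNorm_sq (A : Matrix (Fin k) (Fin k) ℝ) :
    frobNorm A ^ 2 = ∑ i, ∑ j, A i j ^ 2 :=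
  Real.sq_sqrt (Finset.sum_nonneg fun _ _ => Finset.sum_nonneg fun _ _ => sq_nonneg _)

theorem frobNorm_le_of_abs_le {A B : Matrix (Fin k) (Fin k) ℝ}
    (h : ∀ i j, |A i j| ≤ |B i j|) : frobNorm A ≤ frobNorm B :=
  Real.sqrt_le_sqrt <| Finset.sum_le_sum fun i _ => Finset.sum_le_sum fun j _ =>
    sq_le_sq.mpr (h i j)

theorem abs_apply_le_frobNorm (A : Matrix (Fin k) (Fin k) ℝ) (i j : Fin k) :
    |A i j| ≤ frobNorm A := by
  refine Real.abs_le_sqrt ?_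
  calc A i j ^ 2 ≤ ∑ j, A i j ^ 2 :=
        Finset.single_le_sum (f := fun j => A i j ^ 2) (fun _ _ => sq_nonneg _)
          (Finset.mem_univ j)
    _ ≤ ∑ i, ∑ j, A i j ^ 2 :=
        Finset.single_le_sum (f := fun i => ∑ j, A i j ^ 2)
          (fun _ _ => Finset.sum_nonneg fun _ _ => sq_nonneg _) (Finset.mem_univ i)

section

attribute [local instance] Matrix.frobeniusNormedAddCommGroup Matrix.frobeniusNormedRing

theorem frobNorm_eq_norm (A : Matrix (Fin k) (Fin k) ℝ) : frobNorm A = ‖A‖ := by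
  rw [Matrix.frobenius_norm_def, frobNorm, Real.sqrt_eq_rpow]
  simp

theorem frobNorm_sub_le (A B : Matrix (Fin k) (Fin k) ℝ) :
    frobNorm (A - B) ≤ frobNorm A + frobNorm B := by
  simpa only [frobNorm_eq_norm] using norm_sub_le A B

theorem frobNorm_mul_le (A B : Matrix (Fin k) (Fin k) ℝ) :
    frobNorm (A * B) ≤ frobNorm A * frobNorm B := by
  simpa only [frobNorm_eq_norm] using Matrix.frobenius_norm_mul A B

end

theorem frobNorm_transpose (A : Matrix (Fin k) (Fin k) ℝ) : frobNorm Aᵀ = frobNorm A := by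
  simp only [frobNorm, Matrix.transpose_apply]
  rw [Finset.sum_comm]

theorem specNorm_nonneg (A : Matrix (Fin k) (Fin k) ℝ) : 0 ≤ specNorm A :=
  norm_nonneg _

theorem specNorm_transpose (A : Matrix (Fin k) (Fin k) ℝ) : specNorm Aᵀ = specNorm A := by
  have h : Aᵀ = star A := by
    ext i j
    simp [Matrix.star_apply]
  rw [specNorm, h, map_star, ContinuousLinearMap.star_eq_adjoint, LinearIsometryEquiv.norm_map,
    specNorm]

theorem frobNorm_mul_le_specNorm_mul (A B : Matrix (Fin k) (Fin k) ℝ) :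
    frobNorm (A * B) ≤ specNorm A * frobNorm B := by
  refine Real.sqrt_le_iff.mpr ⟨mul_nonneg (specNorm_nonneg A) (frobNorm_nonneg B), ?_⟩
  rw [mul_pow, frobNorm_sq, Finset.sum_comm, Finset.sum_comm (f := fun i j => B i j ^ 2),
    Finset.mul_sum]
  refine Finset.sum_le_sum fun j _ => ?_
  have h := (Matrix.toEuclideanCLM (𝕜 := ℝ) A).le_opNorm (WithLp.toLp 2 fun i => B i j)
  have h2 := pow_le_pow_left₀ (norm_nonneg _) h 2
  rw [mul_pow, EuclideanSpace.norm_sq_eq, EuclideanSpace.norm_sq_eq] at h2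
  simpa [Matrix.mul_apply, Matrix.mulVec, dotProduct, specNorm] using h2

theorem frobNorm_mul_le_mul_specNorm (A B : Matrix (Fin k) (Fin k) ℝ) :
    frobNorm (A * B) ≤ frobNorm A * specNorm B := by
  rw [← frobNorm_transpose, Matrix.transpose_mul, mul_comm (frobNorm A),
    ← specNorm_transpose B, ← frobNorm_transpose A]
  exact frobNorm_mul_le_specNorm_mul _ _

theorem frobNorm_diagonal_mul_of_sq_eq_one {s : Fin k → ℝ} (hs : ∀ i, s i ^ 2 = 1)
    (A : Matrix (Fin k) (Fin k) ℝ) : frobNorm (Matrix.diagonal s * A) = frobNorm A := by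
  simp [frobNorm, Matrix.diagonal_mul, mul_pow, hs]

end FrobNorm

section SignedGram

variable {k : ℕ}

/-- The perturbation `(1 + X) J (1 + X)ᵀ - J` of `J = diagonal s`. -/
noncomputable def signedGramPert (s : Fin k → ℝ) (X : Matrix (Fin k) (Fin k) ℝ) :
    Matrix (Fin k) (Fin k) ℝ :=
  X * Matrix.diagonal s + Matrix.diagonal s * Xᵀ + X * (Matrix.diagonal s * Xᵀ)

theorem signedGramPert_apply (s : Fin k → ℝ) (X : Matrix (Fin k) (Fin k) ℝ) (i j : Fin k) :
    signedGramPert s X i j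
      = X i j * s j + s i * X j i + ∑ l, X i l * (s l * X j l) := by
  simp only [signedGramPert, Matrix.add_apply, Matrix.mul_diagonal, Matrix.diagonal_mul,
    Matrix.transpose_apply]
  simp [Matrix.mul_apply (M := X), Matrix.diagonal_mul]

theorem signedGramPert_comm (s : Fin k → ℝ) (X : Matrix (Fin k) (Fin k) ℝ) (i j : Fin k) :
    signedGramPert s X i j = signedGramPert s X j i := by
  rw [signedGramPert_apply, signedGramPert_apply,
    Finset.sum_congr rfl fun l _ => (by ring : X i l * (s l * X j l) = X j l * (s l * X i l))]
  ring

theorem IsLowerTri.two_mul_frobNorm_sq_le {X : Matrix (Fin k) (Fin k) ℝ} (hX : IsLowerTri X)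
    {s : Fin k → ℝ} (hs : ∀ i, s i ^ 2 = 1) :
    2 * frobNorm X ^ 2
      ≤ frobNorm (X * Matrix.diagonal s + Matrix.diagonal s * Xᵀ) ^ 2 := by
  have h2 : 2 * frobNorm X ^ 2 = ∑ i, ∑ j, (X i j ^ 2 + X j i ^ 2) := by
    simp only [Finset.sum_add_distrib]
    rw [Finset.sum_comm (f := fun i j => X j i ^ 2), frobNorm_sq]
    ring
  rw [h2, frobNorm_sq]
  refine Finset.sum_le_sum fun i _ => Finset.sum_le_sum fun j _ => ?_
  simp only [Matrix.add_apply, Matrix.mul_diagonal, Matrix.diagonal_mul, Matrix.transpose_apply]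
  have hi := hs i
  have hj := hs j
  rcases lt_trichotomy i j with h | rfl | h
  · rw [hX i j h]
    nlinarith
  · nlinarith [sq_nonneg (X i i)]
  · rw [hX j i h]
    nlinarith

theorem frobNorm_mul_diagonal_mul_transpose_le {s : Fin k → ℝ} (hs : ∀ i, s i ^ 2 = 1)
    (A X : Matrix (Fin k) (Fin k) ℝ) :
    frobNorm (A * (Matrix.diagonal s * Xᵀ)) ≤ frobNorm A * frobNorm X := by
  refine (frobNorm_mul_le _ _).trans_eq ?_
  rw [frobNorm_diagonal_mul_of_sq_eq_one hs, frobNorm_transpose]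

theorem IsLowerTri.frobNorm_sq_ne_half {X : Matrix (Fin k) (Fin k) ℝ} (hX : IsLowerTri X)
    {s : Fin k → ℝ} (hs : ∀ i, s i ^ 2 = 1) (hE : frobNorm (signedGramPert s X) < 1 / 2) :
    frobNorm X ^ 2 ≠ 1 / 2 := by
  intro h
  have h1 := hX.two_mul_frobNorm_sq_le hs
  have h2 : frobNorm (X * Matrix.diagonal s + Matrix.diagonal s * Xᵀ)
      ≤ frobNorm (signedGramPert s X) + frobNorm (X * (Matrix.diagonal s * Xᵀ)) := by
    refine le_trans (le_of_eq ?_) (frobNorm_sub_le _ _)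
    rw [signedGramPert, add_sub_cancel_right]
  have h3 := frobNorm_mul_diagonal_mul_transpose_le hs X X
  have h4 := frobNorm_nonneg (X * Matrix.diagonal s + Matrix.diagonal s * Xᵀ)
  nlinarith

/-- Keep the rows of `X` before row `r`, replace row `r` by `t` times its off-diagonal part
with `x` on the diagonal, and clear the later rows. -/
noncomputable def truncRow (X : Matrix (Fin k) (Fin k) ℝ) (r : Fin k) (t x : ℝ) :
    Matrix (Fin k) (Fin k) ℝ :=
  Matrix.of fun i j =>
    if i < r then X i j else if i = r then (if j = r then x else t * X r j) else 0

theorem truncRow_of_lt (X : Matrix (Fin k) (Fin k) ℝ) {r i : Fin k} (t x : ℝ) (h : i < r)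
    (j : Fin k) : truncRow X r t x i j = X i j := by
  simp [truncRow, h]

theorem truncRow_self (X : Matrix (Fin k) (Fin k) ℝ) (r : Fin k) (t x : ℝ) (j : Fin k) :
    truncRow X r t x r j = if j = r then x else t * X r j := by
  simp [truncRow]

theorem truncRow_of_gt (X : Matrix (Fin k) (Fin k) ℝ) {r i : Fin k} (t x : ℝ) (h : r < i)
    (j : Fin k) : truncRow X r t x i j = 0 := by
  simp [truncRow, h.ne', h.not_gt]

theorem IsLowerTri.isLowerTri_truncRow {X : Matrix (Fin k) (Fin k) ℝ} (hX : IsLowerTri X)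
    (r : Fin k) (t x : ℝ) : IsLowerTri (truncRow X r t x) := by
  intro i j hij
  rcases lt_trichotomy i r with h | rfl | h
  · rw [truncRow_of_lt X t x h, hX i j hij]
  · rw [truncRow_self, if_neg hij.ne', hX i j hij, mul_zero]
  · exact truncRow_of_gt X t x h j

theorem IsLowerTri.abs_signedGramPert_truncRow_le {X : Matrix (Fin k) (Fin k) ℝ}
    (hX : IsLowerTri X) (s : Fin k → ℝ) (r : Fin k) {t x : ℝ} (ht0 : 0 ≤ t) (ht1 : t ≤ 1)
    (hx : 2 * x * s r + s r * x ^ 2 + t ^ 2 * ∑ l ∈ Finset.univ.erase r, s l * X r l ^ 2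
      = t * signedGramPert s X r r) (i j : Fin k) :
    |signedGramPert s (truncRow X r t x) i j| ≤ |signedGramPert s X i j| := by
  wlog hji : j ≤ i generalizing i j
  · rw [signedGramPert_comm s _ i j, signedGramPert_comm s X i j]
    exact this j i (le_of_not_ge hji)
  have hshrink : ∀ a : ℝ, |t * a| ≤ |a| := fun a => by
    rw [abs_mul, abs_of_nonneg ht0]
    exact mul_le_of_le_one_left (abs_nonneg a) ht1
  rcases lt_trichotomy i r with hi | rfl | hi
  · have hj := hji.trans_lt hi
    simp only [signedGramPert_apply, truncRow_of_lt X t x hi, truncRow_of_lt X t x hj, le_refl]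
  · rcases hji.eq_or_lt with rfl | hj
    · have hval : signedGramPert s (truncRow X j t x) j j
          = t * signedGramPert s X j j := by
        rw [← hx, signedGramPert_apply, ← Finset.add_sum_erase _ _ (Finset.mem_univ j),
          Finset.mul_sum]
        have hsum : ∑ l ∈ Finset.univ.erase j,
            truncRow X j t x j l * (s l * truncRow X j t x j l)
            = ∑ l ∈ Finset.univ.erase j, t ^ 2 * (s l * X j l ^ 2) := by
          refine Finset.sum_congr rfl fun l hl => ?_
          rw [truncRow_self, if_neg (Finset.ne_of_mem_erase hl)]
          ring
        rw [hsum, truncRow_self, if_pos rfl]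
        ring
      rw [hval]
      exact hshrink _
    · have hval : signedGramPert s (truncRow X i t x) i j
          = t * signedGramPert s X i j := by
        rw [signedGramPert_apply, signedGramPert_apply, mul_add, Finset.mul_sum]
        congr 1
        · rw [truncRow_self, if_neg hj.ne, truncRow_of_lt X t x hj, hX j i hj]
          ring
        · refine Finset.sum_congr rfl fun l _ => ?_
          rw [truncRow_self, truncRow_of_lt X t x hj]
          split_ifs with h
          · rw [h, hX j i hj]
            ring
          · ring
      rw [hval]
      exact hshrink _
  · have hval : signedGramPert s (truncRow X r t x) i j = 0 := by
      rw [signedGramPert_apply]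
      simp only [truncRow_of_gt X t x hi, zero_mul, zero_add, Finset.sum_const_zero, add_zero]
      rcases hji.eq_or_lt with rfl | hj
      · rw [truncRow_of_gt X t x hi, mul_zero]
      · rw [hX.isLowerTri_truncRow r t x j i hj, mul_zero]
    rw [hval, abs_zero]
    exact abs_nonneg _

theorem continuous_frobNorm_truncRow_sq (X : Matrix (Fin k) (Fin k) ℝ) (r : Fin k)
    {x : ℝ → ℝ} (hx : Continuous x) :
    Continuous fun t => frobNorm (truncRow X r t (x t)) ^ 2 := by
  simp only [frobNorm_sq]
  refine continuous_finsetSum _ fun i _ => continuous_finsetSum _ fun j _ => ?_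
  refine Continuous.pow ?_ 2
  simp only [truncRow, Matrix.of_apply]
  split_ifs <;> fun_prop

theorem IsLowerTri.frobNorm_truncRow_sq_lt_half {X : Matrix (Fin k) (Fin k) ℝ}
    (hX : IsLowerTri X) (hd : ∀ i, 0 < 1 + X i i) {s : Fin k → ℝ} (hs : ∀ i, s i ^ 2 = 1)
    (hE : frobNorm (signedGramPert s X) < 1 / 2) (r : Fin k)
    (h0 : frobNorm (truncRow X r 0 0) ^ 2 < 1 / 2) :
    frobNorm (truncRow X r 1 (X r r)) ^ 2 < 1 / 2 := by
  set R := ∑ l ∈ Finset.univ.erase r, s l * X r l ^ 2 with hR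
  set c := signedGramPert s X r r with hc
  have hcR : c = 2 * X r r * s r + s r * X r r ^ 2 + R := by
    rw [hc, signedGramPert_apply, ← Finset.add_sum_erase _ _ (Finset.mem_univ r),
      Finset.sum_congr rfl fun l _ => (by ring : X r l * (s l * X r l) = s l * X r l ^ 2)]
    ring
  have hsr := hs r
  have hc2 : |s r * c| < 1 / 2 := by
    have : |s r| = 1 := by
      rw [← sq_eq_sq₀ (abs_nonneg _) zero_le_one, sq_abs, hsr, one_pow]
    rw [abs_mul, this, one_mul]
    exact (abs_apply_le_frobNorm _ r r).trans_lt hE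
  set f : ℝ → ℝ := fun t => 1 + s r * (t * c - t ^ 2 * R) with hf
  have hf1 : f 1 = (1 + X r r) ^ 2 := by
    simp only [hf, hcR]
    linear_combination (2 * X r r + X r r ^ 2) * hsr
  have hf1' : 1 + s r * c - s r * R = (1 + X r r) ^ 2 := by
    rw [← hf1]
    simp only [hf]
    ring
  have hfnn : ∀ t ∈ Set.Icc (0 : ℝ) 1, 0 ≤ f t := by
    rintro t ⟨ht0, ht1⟩
    have hft : f t = 1 + t * (s r * c) - t ^ 2 * (s r * R) := by
      simp only [hf]
      ring
    rw [hft]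
    rw [abs_lt] at hc2
    rcases le_total 0 (s r * R) with h | h
    · nlinarith [mul_nonneg (mul_nonneg ht0 (sub_nonneg.mpr ht1)) h,
        mul_nonneg ht0 (sq_nonneg (1 + X r r))]
    · nlinarith [mul_nonneg (sq_nonneg t) (neg_nonneg.mpr h)]
  set x : ℝ → ℝ := fun t => Real.sqrt (f t) - 1 with hxdef
  have hx0 : x 0 = 0 := by simp [hxdef, hf]
  have hx1 : x 1 = X r r := by
    simp only [hxdef, hf1, Real.sqrt_sq (hd r).le]
    ring
  have hxc : Continuous x := by
    simp only [hxdef, hf]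
    fun_prop
  have hne : ∀ t ∈ Set.Icc (0 : ℝ) 1, frobNorm (truncRow X r t (x t)) ^ 2 ≠ 1 / 2 := by
    intro t ht
    refine (hX.isLowerTri_truncRow r t (x t)).frobNorm_sq_ne_half hs (lt_of_le_of_lt ?_ hE)
    refine frobNorm_le_of_abs_le (hX.abs_signedGramPert_truncRow_le s r ht.1 ht.2 ?_)
    have hsq : (x t + 1) ^ 2 = 1 + s r * (t * c - t ^ 2 * R) := by
      simp only [hxdef, sub_add_cancel]
      exact Real.sq_sqrt (hfnn t ht)
    rw [← hR, ← hc]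
    linear_combination s r * hsq + (t * c - t ^ 2 * R) * hsr
  by_contra! hcon
  rw [← hx1] at hcon
  have h0' : frobNorm (truncRow X r 0 (x 0)) ^ 2 ≤ 1 / 2 := by
    rw [hx0]
    exact h0.le
  obtain ⟨t, ht, hteq⟩ := intermediate_value_Icc (zero_le_one' ℝ)
    (continuous_frobNorm_truncRow_sq X r hxc).continuousOn (Set.mem_Icc.mpr ⟨h0', hcon⟩)
  exact hne t ht hteq

theorem IsLowerTri.frobNorm_sq_lt_half {X : Matrix (Fin k) (Fin k) ℝ}
    (hX : IsLowerTri X) (hd : ∀ i, 0 < 1 + X i i) {s : Fin k → ℝ} (hs : ∀ i, s i ^ 2 = 1)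
    (hE : frobNorm (signedGramPert s X) < 1 / 2) : frobNorm X ^ 2 < 1 / 2 := by
  have key : ∀ p : ℕ, p ≤ k →
      frobNorm (Matrix.of fun i j => if (i : ℕ) < p then X i j else 0) ^ 2 < 1 / 2 := by
    intro p
    induction p with
    | zero =>
      intro _
      rw [frobNorm_sq]
      simp
    | succ p ih =>
      intro hp
      have h := hX.frobNorm_truncRow_sq_lt_half hd hs hE ⟨p, hp⟩ ?_
      · convert h using 3
        ext i j
        rcases lt_trichotomy i ⟨p, hp⟩ with hi | rfl | hi
        · rw [truncRow_of_lt X _ _ hi, Matrix.of_apply, if_pos (Nat.lt_succ_of_lt hi)]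
        · rw [truncRow_self, Matrix.of_apply, if_pos (Nat.lt_succ_self p)]
          split_ifs with hj
          · rw [hj]
          · rw [one_mul]
        · rw [truncRow_of_gt X _ _ hi, Matrix.of_apply,
            if_neg (Nat.not_lt.mpr (Nat.succ_le_of_lt hi))]
      · convert ih (Nat.le_of_succ_le hp) using 3
        ext i j
        rcases lt_trichotomy i ⟨p, hp⟩ with hi | rfl | hi
        · rw [truncRow_of_lt X _ _ hi, Matrix.of_apply, if_pos (Fin.lt_def.mp hi)]
        · rw [truncRow_self, Matrix.of_apply, if_neg (lt_irrefl p)]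
          split_ifs <;> simp
        · rw [truncRow_of_gt X _ _ hi, Matrix.of_apply, if_neg (Nat.not_lt.mpr hi.le)]
  convert key k le_rfl using 3
  ext i j
  simp

theorem IsLowerTri.frobNorm_diagonal_mul_le {X : Matrix (Fin k) (Fin k) ℝ}
    (hX : IsLowerTri X) {s : Fin k → ℝ} (hs : ∀ i, s i ^ 2 = 1) (d : Fin k → ℝ) :
    frobNorm (Matrix.diagonal d * X)
      ≤ frobNorm (Matrix.diagonal d * signedGramPert s X)
        + frobNorm (Matrix.diagonal d * X) * frobNorm X := by
  have h := frobNorm_sub_le (Matrix.diagonal d * signedGramPert s X)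
    (Matrix.diagonal d * X * (Matrix.diagonal s * Xᵀ))
  have h2 := frobNorm_mul_diagonal_mul_transpose_le hs (Matrix.diagonal d * X) X
  rw [Matrix.mul_assoc (Matrix.diagonal d) X, ← Matrix.mul_sub, signedGramPert,
    add_sub_cancel_right, ← Matrix.mul_assoc (Matrix.diagonal d) X] at h
  refine le_trans ?_ (h.trans (add_le_add le_rfl h2))
  refine frobNorm_le_of_abs_le fun i j => ?_
  simp only [Matrix.diagonal_mul, Matrix.add_apply, Matrix.mul_diagonal, Matrix.transpose_apply]
  refine sq_le_sq.mp ?_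
  have hj := hs j
  rcases lt_trichotomy i j with hij | rfl | hij
  · rw [hX i j hij, mul_zero, zero_pow two_ne_zero]
    exact sq_nonneg _
  · have : (d i * (X i i * s i + s i * X i i)) ^ 2 = 4 * (d i * X i i) ^ 2 := by
      linear_combination 4 * (d i * X i i) ^ 2 * hj
    nlinarith [sq_nonneg (d i * X i i)]
  · rw [hX j i hij]
    refine le_of_eq ?_
    linear_combination -(d i * X i j) ^ 2 * hj

end SignedGram

section LowerTri

variable {k : ℕ}

theorem IsLowerTri.blockTriangular {A : Matrix (Fin k) (Fin k) ℝ} (hA : IsLowerTri A) :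
    A.BlockTriangular OrderDual.toDual :=
  fun i j h => hA i j h

theorem IsLowerTri.isUnit_det {A : Matrix (Fin k) (Fin k) ℝ} (hA : IsLowerTri A)
    (hd : PosDiag A) : IsUnit A.det := by
  rw [Matrix.det_of_isLowerTriangular A hA.blockTriangular]
  exact (Finset.prod_pos fun i _ => hd i).ne'.isUnit

theorem IsLowerTri.inv_mul {A B : Matrix (Fin k) (Fin k) ℝ} (hA : IsLowerTri A)
    (hB : IsLowerTri B) (hu : IsUnit A.det) : IsLowerTri (A⁻¹ * B) := by
  let := A.invertibleOfIsUnitDet hu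
  intro i j h
  exact ((Matrix.blockTriangular_inv_of_blockTriangular hA.blockTriangular).mul
    hB.blockTriangular) (i := i) (j := j) h

theorem IsLowerTri.mul_apply_self {A B : Matrix (Fin k) (Fin k) ℝ} (hA : IsLowerTri A)
    (hB : IsLowerTri B) (i : Fin k) : (A * B) i i = A i i * B i i := by
  rw [Matrix.mul_apply]
  refine Finset.sum_eq_single i (fun l _ hl => ?_) fun h => absurd (Finset.mem_univ i) h
  rcases lt_or_gt_of_ne hl with h | h
  · rw [hB l i h, mul_zero]
  · rw [hA i l h, zero_mul]

end LowerTri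

theorem stmt9 (m n : ℕ) (K L dK dL D : Matrix (Fin (m + n)) (Fin (m + n)) ℝ)
    (hK : Kᵀ = K) (hL : IsLowerTri L) (hLd : PosDiag L)
    (hfact : K = L * Jmat m n * Lᵀ)
    (hdK : dKᵀ = dK)
    (hsmall : specNorm L⁻¹ ^ 2 * frobNorm dK < 1 / 2)
    (hL' : IsLowerTri (L + dL)) (hL'd : PosDiag (L + dL))
    (hfact' : K + dK = (L + dL) * Jmat m n * (L + dL)ᵀ)
    (hD : D.IsDiag) (hDpos : ∀ i, 0 < D i i) :
    frobNorm dL ≤ (2 + Real.sqrt 2) * specNorm L⁻¹ * kappa2 (L * D⁻¹) * frobNorm dK := by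
  set s : Fin (m + n) → ℝ := fun i => if (i : ℕ) < m then 1 else -1 with hsdef
  have hs : ∀ i, s i ^ 2 = 1 := fun i => by
    simp only [hsdef]
    split_ifs <;> norm_num
  have hLu : IsUnit L.det := hL.isUnit_det hLd
  have hdLtri : IsLowerTri dL := fun i j h => by
    have h1 := hL' i j h
    rwa [Matrix.add_apply, hL i j h, zero_add] at h1
  obtain ⟨X, hXdef⟩ : ∃ X, X = L⁻¹ * dL := ⟨_, rfl⟩
  have hX : IsLowerTri X := hXdef ▸ hL.inv_mul hdLtri hLu
  have hLX : L * X = dL := by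
    rw [hXdef, Matrix.mul_nonsing_inv_cancel_left _ _ hLu]
  have hXd : ∀ i, 0 < 1 + X i i := fun i => by
    have h1 := hL'd i
    rw [← hLX, Matrix.add_apply, hL.mul_apply_self hX, ← mul_one_add] at h1
    exact (mul_pos_iff_of_pos_left (hLd i)).mp h1
  have hdKfact : dK = L * signedGramPert s X * Lᵀ := by
    have hJ : Jmat m n = Matrix.diagonal s := rfl
    have h1 : dK = (L + dL) * Jmat m n * (L + dL)ᵀ - K := by
      rw [← hfact', add_sub_cancel_left]
    rw [h1, hfact, hJ, ← hLX, signedGramPert]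
    simp only [Matrix.transpose_add, Matrix.transpose_mul, Matrix.mul_add, Matrix.add_mul,
      Matrix.mul_assoc]
    abel
  have hEq : signedGramPert s X = L⁻¹ * dK * (L⁻¹)ᵀ := by
    have hLt : Lᵀ * (L⁻¹)ᵀ = 1 := by
      rw [← Matrix.transpose_mul, Matrix.nonsing_inv_mul _ hLu, Matrix.transpose_one]
    rw [hdKfact, Matrix.mul_assoc L, Matrix.nonsing_inv_mul_cancel_left _ _ hLu,
      Matrix.mul_assoc, hLt, Matrix.mul_one]
  have hbound : ∀ A, frobNorm (A * dK * (L⁻¹)ᵀ)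
      ≤ specNorm A * frobNorm dK * specNorm L⁻¹ := fun A => by
    refine (frobNorm_mul_le_mul_specNorm _ _).trans ?_
    rw [specNorm_transpose]
    exact mul_le_mul_of_nonneg_right (frobNorm_mul_le_specNorm_mul _ _) (specNorm_nonneg _)
  have hE : frobNorm (signedGramPert s X) < 1 / 2 := by
    rw [hEq]
    refine (hbound _).trans_lt (lt_of_eq_of_lt ?_ hsmall)
    ring
  have hXlt := hX.frobNorm_sq_lt_half hXd hs hE
  obtain ⟨d, rfl⟩ : ∃ d, D = Matrix.diagonal d := ⟨D.diag, hD.diagonal_diag.symm⟩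
  have hDu : IsUnit (Matrix.diagonal d).det := by
    rw [Matrix.det_diagonal]
    refine (Finset.prod_pos fun i _ => ?_).ne'.isUnit
    simpa using hDpos i
  have hz := hX.frobNorm_diagonal_mul_le hs d
  have hDE : frobNorm (Matrix.diagonal d * signedGramPert s X)
      ≤ specNorm (L * (Matrix.diagonal d)⁻¹)⁻¹ * frobNorm dK * specNorm L⁻¹ := by
    rw [hEq, Matrix.mul_inv_rev, Matrix.nonsing_inv_nonsing_inv _ hDu, ← Matrix.mul_assoc,
      ← Matrix.mul_assoc]
    exact hbound _
  have hdLle : frobNorm dL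
      ≤ specNorm (L * (Matrix.diagonal d)⁻¹) * frobNorm (Matrix.diagonal d * X) := by
    refine le_trans (le_of_eq ?_) (frobNorm_mul_le_specNorm_mul _ _)
    rw [Matrix.mul_assoc, Matrix.nonsing_inv_mul_cancel_left _ _ hDu, hLX]
  have hzle : frobNorm (Matrix.diagonal d * X) ≤ (2 + Real.sqrt 2) *
      (specNorm (L * (Matrix.diagonal d)⁻¹)⁻¹ * frobNorm dK * specNorm L⁻¹) := by
    have hsq : Real.sqrt 2 ^ 2 = 2 := Real.sq_sqrt zero_le_two
    have hsq0 : 0 ≤ Real.sqrt 2 := Real.sqrt_nonneg 2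
    have hx : frobNorm X ≤ Real.sqrt 2 / 2 := by
      refine le_of_sq_le_sq ?_ (by positivity)
      rw [div_pow, hsq]
      linarith
    have hz0 := frobNorm_nonneg (Matrix.diagonal d * X)
    have h1 : frobNorm (Matrix.diagonal d * X) * (1 - Real.sqrt 2 / 2)
        ≤ specNorm (L * (Matrix.diagonal d)⁻¹)⁻¹ * frobNorm dK * specNorm L⁻¹ := by
      nlinarith [mul_le_mul_of_nonneg_left hx hz0]
    have h2 := mul_le_mul_of_nonneg_left h1 (by positivity : 0 ≤ 2 + Real.sqrt 2)
    refine le_trans (le_of_eq ?_) h2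
    linear_combination (frobNorm (Matrix.diagonal d * X) / 2) * hsq
  refine hdLle.trans ((mul_le_mul_of_nonneg_left hzle (specNorm_nonneg _)).trans_eq ?_)
  rw [kappa2]
  ring
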